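/- For an odd integer l ≥ 5, Σ over l1≥2, l3≥1 with l1+l3 = l-1 and l1, l3 both even of ζ(l1,1,l3) equals (1/4)·ζ(l) + ζ(l-1,1) + (1/2)·ζ(2,l-2), and Σ over l1≥3, l3≥1 with l1+l3 = l-1 and l1, l3 both odd of ζ(l1,1,l3) equals -(1/4)·ζ(l) + (1/2)·ζ(2,l-2). -/

import Mathlib

/-- Riemann zeta value -/
noncomputable def rz (l : ℕ) : ℝ :=
  ∑' m : ℕ, if 0 < m then 1 / (m : ℝ) ^ l else 0

/-- double zeta value -/
noncomputable def dz (a b : ℕ) : ℝ :=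
  ∑' p : ℕ × ℕ, if p.2 < p.1 ∧ 0 < p.2 then
    1 / ((p.1 : ℝ) ^ a * (p.2 : ℝ) ^ b) else 0

/-- triple zeta value -/
noncomputable def tz (a b c : ℕ) : ℝ :=
  ∑' t : ℕ × ℕ × ℕ, if t.2.1 < t.1 ∧ t.2.2 < t.2.1 ∧ 0 < t.2.2 then
    1 / ((t.1 : ℝ) ^ a * (t.2.1 : ℝ) ^ b * (t.2.2 : ℝ) ^ c) else 0

/-- admissible triple indices of weight l -/
def TIdx (l : ℕ) : Finset (ℕ × ℕ × ℕ) :=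
  (Finset.range (l + 1) ×ˢ Finset.range (l + 1) ×ˢ Finset.range (l + 1)).filter
    (fun t => 2 ≤ t.1 ∧ 1 ≤ t.2.1 ∧ 1 ≤ t.2.2 ∧ t.1 + t.2.1 + t.2.2 = l)

open Filter Topology Finset in
theorem hasSum_one_div_mul_add (x : ℝ) (hx : 0 < x) (c : ℕ) (hc : 0 < c) :
    HasSum (fun k : ℕ => 1 / ((x + k) * (x + k + c))) (1 / c * ∑ j ∈ range c, 1 / (x + j)) := by
  have hc' : (0 : ℝ) < c := by exact_mod_cast hc
  rw [hasSum_iff_tendsto_nat_of_nonneg (fun k => by positivity)]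
  have key : ∀ N : ℕ, ∑ k ∈ range N, 1 / ((x + k) * (x + k + c)) =
      1 / c * ∑ j ∈ range c, 1 / (x + j) - 1 / c * ∑ j ∈ range c, 1 / (x + N + j) := by
    intro N
    induction N with
    | zero => simp
    | succ N ih =>
      have h1 := sum_range_succ (fun j : ℕ => 1 / (x + N + j)) c
      rw [sum_range_succ'] at h1
      have h2 : ∑ j ∈ range c, 1 / (x + (N + 1 : ℕ) + j) =
          ∑ j ∈ range c, 1 / (x + N + (j + 1 : ℕ)) :=
        sum_congr rfl fun j _ => by push_cast; ring_nf
      have h3 : ∑ j ∈ range c, 1 / (x + N + (j + 1 : ℕ)) =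
        ∑ j ∈ range c, 1 / (x + N + j) + 1 / (x + N + c) - 1 / (x + N) := by
        rw [← h1]; simp
      rw [sum_range_succ, ih, h2, h3]
      field_simp
      ring
  simp_rw [key]
  have hlim : Tendsto (fun N : ℕ => ∑ j ∈ range c, 1 / (x + N + j)) atTop (𝓝 (∑ j ∈ range c, 0)) := by
    refine tendsto_finsetSum _ fun j _ => ?_
    refine Tendsto.div_atTop tendsto_const_nhds ?_
    exact tendsto_atTop_add_const_right _ _
      (tendsto_atTop_add_const_left _ _ tendsto_natCast_atTop_atTop)
  simpa using (hlim.const_mul (1 / (c : ℝ))).const_sub (1 / c * ∑ j ∈ range c, 1 / (x + j))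

theorem hasSum_ite_lt {f : ℕ → ℝ} {s : ℝ} (b : ℕ) (h : HasSum (fun k => f (b + 1 + k)) s) :
    HasSum (fun a => if b < a then f a else 0) s := by
  have hinj : Function.Injective (fun k : ℕ => b + 1 + k) := fun _ _ h => by simpa using h
  refine (hinj.hasSum_iff (fun a ha => ?_)).1 ?_
  · refine if_neg fun hba => ha ⟨a - (b + 1), ?_⟩
    change b + 1 + (a - (b + 1)) = a
    omega
  · refine h.congr_fun fun k => ?_
    simp only [Function.comp]
    rw [if_pos (by omega)]

theorem hasSum_prod_of_nonneg {α β : Type*} {f : α × β → ℝ} (hf : ∀ p, 0 ≤ f p) {g : α → ℝ} {s : ℝ}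
    (hg : ∀ a, HasSum (fun b => f (a, b)) (g a)) (hs : HasSum g s) : HasSum f s := by
  have hsum : Summable f := by
    rw [summable_prod_of_nonneg hf]
    exact ⟨fun a => (hg a).summable, hs.summable.congr fun a => (hg a).tsum_eq.symm⟩
  have := hsum.hasSum.prod_fiberwise hg
  rw [hs.unique this]
  exact hsum.hasSum

/-- The sum of `1 / (b * (a - s * c))` over `0 < c < b < a`, with `b = j + 1` and `c = i + 1`. -/
noncomputable def innerSum (s : ℝ) (a : ℕ) : ℝ :=
  ∑ j ∈ Finset.range (a - 1), 1 / ((j : ℝ) + 1) * ∑ i ∈ Finset.range j, 1 / (a - s * ((i : ℝ) + 1))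

theorem one_le_sub_mul {s : ℝ} (hs : s = 1 ∨ s = -1) {a c : ℕ} (h : c < a) :
    (1 : ℝ) ≤ a - s * c := by
  have h' : (c : ℝ) + 1 ≤ a := by exact_mod_cast h
  have : (0 : ℝ) ≤ c := c.cast_nonneg
  rcases hs with rfl | rfl <;> linarith

theorem innerSum_nonneg {s : ℝ} (hs : s = 1 ∨ s = -1) (a : ℕ) : 0 ≤ innerSum s a := by
  refine Finset.sum_nonneg fun j hj => mul_nonneg (by positivity) (Finset.sum_nonneg fun i hi => ?_)
  simp only [Finset.mem_range] at hi hj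
  have := one_le_sub_mul hs (a := a) (c := i + 1) (by omega)
  push_cast at this
  exact one_div_nonneg.2 (by linarith)

theorem innerSum_le {s : ℝ} (hs : s = 1 ∨ s = -1) (a : ℕ) : innerSum s a ≤ a := by
  have h : innerSum s a ≤ ∑ j ∈ Finset.range (a - 1), (1 : ℝ) := by
    refine Finset.sum_le_sum fun j hj => ?_
    have h1 : ∑ i ∈ Finset.range j, 1 / (a - s * ((i : ℝ) + 1)) ≤ ∑ i ∈ Finset.range j, (1 : ℝ) := by
      refine Finset.sum_le_sum fun i hi => ?_
      simp only [Finset.mem_range] at hi hj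
      have := one_le_sub_mul hs (a := a) (c := i + 1) (by omega)
      push_cast at this
      exact (div_le_one (by linarith)).2 this
    simp only [Finset.sum_const, Finset.card_range, nsmul_eq_mul, mul_one] at h1
    rw [one_div_mul_eq_div, div_le_one (by positivity)]
    linarith
  refine h.trans ?_
  simp

theorem hasSum_innerSum {s : ℝ} (hs : s = 1 ∨ s = -1) (a : ℕ) :
    HasSum (fun p : ℕ × ℕ => if p.1 < a ∧ p.2 < p.1 ∧ 0 < p.2 then
      1 / (p.1 * ((a : ℝ) - s * p.2)) else 0) (innerSum s a) := by
  have key (b : ℕ) : HasSum (fun c : ℕ => if b < a ∧ c < b ∧ 0 < c then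
      1 / (b * ((a : ℝ) - s * c)) else 0)
      (if b < a then ∑ i ∈ Finset.range (b - 1), 1 / (b * (a - s * ((i : ℝ) + 1))) else 0) := by
    split_ifs with hb
    · simp only [hb, true_and]
      have h := hasSum_sum_of_ne_finset_zero (L := .unconditional ℕ) (s := Finset.range b)
        (f := fun c : ℕ => if c < b ∧ 0 < c then 1 / (b * ((a : ℝ) - s * c)) else 0)
        (fun c hc => if_neg fun h => hc (Finset.mem_range.2 h.1))
      convert h using 1
      rcases b with _ | b
      · simp
      · rw [Finset.sum_range_succ']
        simp only [lt_irrefl, and_false, if_false, add_zero, Nat.add_sub_cancel]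
        refine Finset.sum_congr rfl fun i hi => ?_
        rw [Finset.mem_range] at hi
        rw [if_pos ⟨by omega, by omega⟩]
        push_cast
        rfl
    · simp [hb, hasSum_zero]
  refine hasSum_prod_of_nonneg (fun p => ?_) key ?_
  · split_ifs with h
    · have := one_le_sub_mul hs (a := a) (c := p.2) (by omega)
      exact one_div_nonneg.2 (mul_nonneg (by positivity) (by linarith))
    · rfl
  · have h := hasSum_sum_of_ne_finset_zero (L := .unconditional ℕ) (s := Finset.range a)
      (f := fun b : ℕ => if b < a then
        ∑ i ∈ Finset.range (b - 1), 1 / (b * (a - s * ((i : ℝ) + 1))) else 0)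
      (fun b hb => if_neg fun h => hb (Finset.mem_range.2 h))
    convert h using 1
    rcases a with _ | a
    · simp [innerSum]
    · rw [Finset.sum_range_succ']
      simp only [Nat.zero_sub, Finset.range_zero, Finset.sum_empty, ite_self, add_zero,
        Nat.add_sub_cancel, innerSum]
      refine Finset.sum_congr rfl fun j hj => ?_
      rw [Finset.mem_range] at hj
      rw [if_pos (by omega), Finset.mul_sum]
      refine Finset.sum_congr rfl fun i _ => ?_
      push_cast
      rw [one_div_mul_one_div]

theorem sum_pow_mul_pow (q : ℕ) (x y : ℝ) :
    (∑ i ∈ Finset.Icc 2 (q + 1), x ^ i * y ^ (q + 2 - i)) * (x - y) = x ^ 2 * y * (x ^ q - y ^ q) := by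
  have h : ∑ i ∈ Finset.Icc 2 (q + 1), x ^ i * y ^ (q + 2 - i) =
      x ^ 2 * y * ∑ k ∈ Finset.range q, x ^ k * y ^ (q - 1 - k) := by
    rw [← Finset.Ico_add_one_right_eq_Icc, Finset.sum_Ico_eq_sum_range, Finset.mul_sum]
    refine Finset.sum_congr (by congr 1) fun k hk => ?_
    rw [Finset.mem_range] at hk
    rw [show q + 2 - (2 + k) = q - 1 - k + 1 by omega]
    ring
  rw [h, mul_assoc, geom_sum₂_mul]

theorem sum_signed_pow {s : ℝ} (hs : s = 1 ∨ s = -1) {q : ℕ} (hq : Even q) {a c : ℕ} (hc : 0 < c)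
    (hca : c < a) : ∑ i ∈ Finset.Icc 2 (q + 1), s ^ i * (1 / ((a : ℝ) ^ i * (c : ℝ) ^ (q + 2 - i))) =
      1 / (a * (a - s * c) * (c : ℝ) ^ q) - 1 / ((a : ℝ) ^ (q + 1) * (a - s * c)) := by
  have ha0 : (a : ℝ) ≠ 0 := by exact_mod_cast (hc.trans hca).ne'
  have hc0 : (c : ℝ) ≠ 0 := by positivity
  have hd : (a : ℝ) - s * c ≠ 0 := (zero_lt_one.trans_le (one_le_sub_mul hs hca)).ne'
  have hs2 : s ^ 2 = 1 := by rcases hs with rfl | rfl <;> norm_num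
  have hsq : s ^ q = 1 := by
    obtain ⟨r, rfl⟩ := hq
    rw [← two_mul, pow_mul, hs2, one_pow]
  have key := sum_pow_mul_pow q (s * (a : ℝ)⁻¹) (c : ℝ)⁻¹
  have e : s * (a : ℝ)⁻¹ - (c : ℝ)⁻¹ = -(a - s * c) / (a * c) := by field_simp; ring
  have hne : s * (a : ℝ)⁻¹ - (c : ℝ)⁻¹ ≠ 0 := by
    rw [e]; exact div_ne_zero (neg_ne_zero.2 hd) (mul_ne_zero ha0 hc0)
  have hL : ∑ i ∈ Finset.Icc 2 (q + 1), s ^ i * (1 / ((a : ℝ) ^ i * (c : ℝ) ^ (q + 2 - i))) =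
      ∑ i ∈ Finset.Icc 2 (q + 1), (s * (a : ℝ)⁻¹) ^ i * (c : ℝ)⁻¹ ^ (q + 2 - i) := by
    refine Finset.sum_congr rfl fun i _ => ?_
    rw [mul_pow, inv_pow, inv_pow, one_div, mul_inv, mul_assoc]
  rw [hL]
  refine mul_right_cancel₀ hne ?_
  rw [key, e, mul_pow, mul_pow, hs2, hsq, inv_pow, inv_pow, inv_pow]
  generalize (a : ℝ) - s * c = d at hd
  field_simp
  ring

/-- The summand of the triple zeta series. -/
noncomputable def tzTerm (a b c : ℕ) (t : ℕ × ℕ × ℕ) : ℝ :=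
  if t.2.1 < t.1 ∧ t.2.2 < t.2.1 ∧ 0 < t.2.2 then
    1 / ((t.1 : ℝ) ^ a * (t.2.1 : ℝ) ^ b * (t.2.2 : ℝ) ^ c) else 0

theorem tzTerm_nonneg (a b c : ℕ) (t : ℕ × ℕ × ℕ) : 0 ≤ tzTerm a b c t := by
  unfold tzTerm
  split_ifs <;> positivity

theorem summable_innerSum_div {s : ℝ} (hs : s = 1 ∨ s = -1) {q : ℕ} (hq : 2 ≤ q) :
    Summable (fun a : ℕ => innerSum s a / (a : ℝ) ^ (q + 1)) := by
  refine Summable.of_nonneg_of_le (fun a => div_nonneg (innerSum_nonneg hs a) (by positivity))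
    (fun a => ?_) (Real.summable_one_div_nat_pow.2 (show 1 < q by omega))
  rcases Nat.eq_zero_or_pos a with rfl | ha
  · simp [innerSum]
  · have : (0 : ℝ) < a := by exact_mod_cast ha
    rw [div_le_div_iff₀ (by positivity) (by positivity), one_mul, pow_succ, mul_comm]
    exact mul_le_mul_of_nonneg_left (innerSum_le hs a) (by positivity)

theorem hasSum_upper {s : ℝ} (hs : s = 1 ∨ s = -1) {q : ℕ} {A : ℕ → ℝ} {S : ℝ}
    (hA : ∀ c : ℕ, 0 < c → HasSum (fun p : ℕ × ℕ => if p.1 < p.2 ∧ c < p.1 then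
      1 / (p.1 * ((p.2 : ℝ) * (p.2 - s * c))) else 0) (A c / c))
    (hS : HasSum (fun c : ℕ => A c / (c : ℝ) ^ (q + 1)) S) :
    HasSum (fun t : ℕ × ℕ × ℕ => if t.2.1 < t.1 ∧ t.2.2 < t.2.1 ∧ 0 < t.2.2 then
      1 / (t.2.1 : ℝ) * (1 / (t.1 * (t.1 - s * t.2.2) * (t.2.2 : ℝ) ^ q)) else 0) S := by
  let e : ℕ × ℕ × ℕ ≃ ℕ × ℕ × ℕ :=
    ⟨fun t => (t.2.2, t.2.1, t.1), fun t => (t.2.2, t.2.1, t.1), fun _ => rfl, fun _ => rfl⟩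
  rw [← e.hasSum_iff]
  refine hasSum_prod_of_nonneg (fun t => ?_) (fun c => ?_) hS
  · dsimp only [Function.comp, e, Equiv.coe_fn_mk]
    split_ifs with h
    · have := one_le_sub_mul hs (a := t.2.2) (c := t.1) (by omega)
      have h2 : 0 ≤ (t.2.2 : ℝ) - s * t.1 := by linarith
      positivity
    · rfl
  · dsimp only [Function.comp, e, Equiv.coe_fn_mk]
    rcases Nat.eq_zero_or_pos c with rfl | hc
    · simp [hasSum_zero]
    · have h := (hA c hc).mul_left (1 / (c : ℝ) ^ q)
      have hv : A c / (c : ℝ) ^ (q + 1) = 1 / (c : ℝ) ^ q * (A c / c) := by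
        rw [pow_succ]; field_simp
      rw [hv]
      refine h.congr_fun fun p => ?_
      simp only [hc, and_true]
      split_ifs
      · simp only [one_div, mul_inv]; ring
      · simp

theorem hasSum_lower {s : ℝ} (hs : s = 1 ∨ s = -1) {q : ℕ} (hq : 2 ≤ q) :
    HasSum (fun t : ℕ × ℕ × ℕ => if t.2.1 < t.1 ∧ t.2.2 < t.2.1 ∧ 0 < t.2.2 then
      1 / (t.2.1 : ℝ) * (1 / ((t.1 : ℝ) ^ (q + 1) * (t.1 - s * t.2.2))) else 0)
      (∑' a : ℕ, innerSum s a / (a : ℝ) ^ (q + 1)) := by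
  refine hasSum_prod_of_nonneg (fun t => ?_) (fun a => ?_) (summable_innerSum_div hs hq).hasSum
  · split_ifs with h
    · have := one_le_sub_mul hs (a := t.1) (c := t.2.2) (by omega)
      have h2 : 0 ≤ (t.1 : ℝ) - s * t.2.2 := by linarith
      positivity
    · rfl
  · have h := (hasSum_innerSum hs a).mul_left (1 / (a : ℝ) ^ (q + 1))
    rw [one_div_mul_eq_div] at h
    refine h.congr_fun fun p => ?_
    split_ifs
    · simp only [one_div, mul_inv]; ring
    · simp

theorem sum_signed_tzTerm {s : ℝ} (hs : s = 1 ∨ s = -1) {q : ℕ} (hq : Even q) (t : ℕ × ℕ × ℕ) :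
    ∑ i ∈ Finset.Icc 2 (q + 1), s ^ i * tzTerm i 1 (q + 2 - i) t =
      (if t.2.1 < t.1 ∧ t.2.2 < t.2.1 ∧ 0 < t.2.2 then
        1 / (t.2.1 : ℝ) * (1 / (t.1 * (t.1 - s * t.2.2) * (t.2.2 : ℝ) ^ q)) else 0) -
      (if t.2.1 < t.1 ∧ t.2.2 < t.2.1 ∧ 0 < t.2.2 then
        1 / (t.2.1 : ℝ) * (1 / ((t.1 : ℝ) ^ (q + 1) * (t.1 - s * t.2.2))) else 0) := by
  unfold tzTerm
  split_ifs with h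
  · rw [← mul_sub, ← sum_signed_pow hs hq h.2.2 (h.2.1.trans h.1), Finset.mul_sum]
    refine Finset.sum_congr rfl fun i _ => ?_
    simp only [one_div, mul_inv, pow_one]
    ring
  · simp

theorem hasSum_signed_tzTerm {s : ℝ} (hs : s = 1 ∨ s = -1) {q : ℕ} (hq : Even q) (hq2 : 2 ≤ q)
    {A : ℕ → ℝ} {S : ℝ}
    (hA : ∀ c : ℕ, 0 < c → HasSum (fun p : ℕ × ℕ => if p.1 < p.2 ∧ c < p.1 then
      1 / (p.1 * ((p.2 : ℝ) * (p.2 - s * c))) else 0) (A c / c))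
    (hS : HasSum (fun c : ℕ => (A c - innerSum s c) / (c : ℝ) ^ (q + 1)) S) :
    HasSum (fun t => ∑ i ∈ Finset.Icc 2 (q + 1), s ^ i * tzTerm i 1 (q + 2 - i) t) S := by
  have hS' : HasSum (fun c : ℕ => A c / (c : ℝ) ^ (q + 1))
      (S + ∑' a : ℕ, innerSum s a / (a : ℝ) ^ (q + 1)) := by
    refine (hS.add (summable_innerSum_div hs hq2).hasSum).congr_fun fun c => ?_
    rw [← add_div, sub_add_cancel]
  have h := (hasSum_upper hs hA hS').sub (hasSum_lower hs hq2)
  rw [add_sub_cancel_right] at h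
  exact h.congr_fun fun t => sum_signed_tzTerm hs hq t

theorem hasSum_ite_lt_one_div_mul_add (c j : ℕ) (x : ℝ) (hx : 0 < x) (y : ℝ) (f : ℕ → ℝ)
    (hf : ∀ k : ℕ, f (c + 1 + k) = 1 / ((x + k) * (x + k + (j + 1 : ℕ))))
    (hy : y = 1 / ((j : ℝ) + 1) * ∑ i ∈ Finset.range (j + 1), 1 / (x + i)) :
    HasSum (fun b => if c < b then f b else 0) y := by
  refine hasSum_ite_lt c ?_
  have h := hasSum_one_div_mul_add x hx (j + 1) j.succ_pos
  rw [show y = 1 / ((j + 1 : ℕ) : ℝ) * ∑ i ∈ Finset.range (j + 1), 1 / (x + i) by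
    rw [hy]; push_cast; rfl]
  exact h.congr_fun hf

theorem hasSum_pair_of_nonneg {c : ℕ} {f : ℕ → ℕ → ℝ} {g : ℕ → ℕ → ℝ} {s : ℕ → ℝ} {y : ℝ}
    (hf : ∀ b a, c < b → b < a → 0 ≤ f b a)
    (hin : ∀ b, c < b → HasSum (fun a => if b < a then f b a else 0)
      (1 / (c : ℝ) * ∑ j ∈ Finset.range c, g j b))
    (hout : ∀ j < c, HasSum (fun b => if c < b then g j b else 0) (s j))
    (hy : y = (∑ j ∈ Finset.range c, s j) / c) :
    HasSum (fun p : ℕ × ℕ => if p.1 < p.2 ∧ c < p.1 then f p.1 p.2 else 0) y := by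
  refine hasSum_prod_of_nonneg (g := fun b => if c < b then
    1 / (c : ℝ) * ∑ j ∈ Finset.range c, g j b else 0) (fun p => ?_) (fun b => ?_) ?_
  · split_ifs with h
    · exact hf _ _ h.2 h.1
    · rfl
  · by_cases hb : c < b
    · simpa only [hb, and_true, if_true] using hin b hb
    · simp [hb, hasSum_zero]
  · have h := (hasSum_sum fun j hj => hout j (Finset.mem_range.1 hj)).mul_left (1 / (c : ℝ))
    rw [one_div_mul_eq_div, ← hy] at h
    refine h.congr_fun fun b => ?_
    split_ifs
    · rfl
    · simp

/-- The tail `∑ 1 / m ^ 2` over `m > c`. -/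
noncomputable def sqTail (c : ℕ) : ℝ := ∑' m : ℕ, if c < m then 1 / (m : ℝ) ^ 2 else 0

theorem hasSum_sqTail (c : ℕ) :
    HasSum (fun m : ℕ => if c < m then 1 / (m : ℝ) ^ 2 else 0) (sqTail c) := by
  refine Summable.hasSum (Summable.of_nonneg_of_le (fun m => ?_) (fun m => ?_)
    (Real.summable_one_div_nat_pow.2 one_lt_two)) <;> split_ifs <;> first | rfl | positivity

theorem sqTail_nonneg (c : ℕ) : 0 ≤ sqTail c :=
  (hasSum_sqTail c).nonneg fun m => by positivity

theorem sqTail_le (c : ℕ) : sqTail c ≤ sqTail 0 := by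
  refine hasSum_le (fun m => ?_) (hasSum_sqTail c) (hasSum_sqTail 0)
  by_cases h : c < m
  · rw [if_pos h, if_pos (by omega)]
  · rw [if_neg h]; positivity

open Finset in
theorem hasSum_upper_one (c : ℕ) (hc : 0 < c) :
    HasSum (fun p : ℕ × ℕ => if p.1 < p.2 ∧ c < p.1 then
      1 / (p.1 * ((p.2 : ℝ) * (p.2 - 1 * c))) else 0)
      ((sqTail c + ∑ j ∈ range (c - 1), 1 / ((j : ℝ) + 1) *
        ∑ i ∈ range (j + 1), 1 / ((c : ℝ) - i)) / c) := by
  refine hasSum_pair_of_nonneg (f := fun b a : ℕ => 1 / (b * ((a : ℝ) * (a - 1 * c))))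
    (g := fun j b => 1 / (b * ((b : ℝ) - j)))
    (s := fun j => if j = 0 then sqTail c else
      1 / (j : ℝ) * ∑ i ∈ range j, 1 / ((c : ℝ) - i)) (fun b a hb ha => ?_) (fun b hb => ?_)
    (fun j hj => ?_) ?_
  · have := one_le_sub_mul (Or.inl rfl : (1 : ℝ) = 1 ∨ _) (hb.trans ha)
    have h2 : 0 ≤ (a : ℝ) - 1 * c := by linarith
    positivity
  · refine hasSum_ite_lt b ?_
    have hcb : (c : ℝ) < b := by exact_mod_cast hb
    have h := (hasSum_one_div_mul_add ((b : ℝ) - c + 1) (by linarith) c hc).mul_left (1 / (b : ℝ))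
    have hv : 1 / (c : ℝ) * ∑ j ∈ range c, 1 / (b * ((b : ℝ) - j)) =
        1 / (b : ℝ) * (1 / c * ∑ j ∈ range c, 1 / ((b : ℝ) - c + 1 + j)) := by
      rw [mul_left_comm, mul_sum (range c) _ (1 / (b : ℝ)), ← sum_range_reflect]
      congr 1
      refine sum_congr rfl fun j hj => ?_
      rw [mem_range] at hj
      rw [Nat.sub_sub, Nat.cast_sub (by omega), one_div_mul_one_div]
      push_cast
      ring_nf
    rw [hv]
    refine h.congr_fun fun k => ?_
    rw [one_div_mul_one_div]
    push_cast
    ring_nf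
  · rcases j with _ | j
    · simpa [sq] using hasSum_sqTail c
    · have hjc : ((j + 1 : ℕ) : ℝ) < c := by exact_mod_cast hj
      push_cast at hjc
      refine hasSum_ite_lt_one_div_mul_add c j (c - j) (by linarith) _ _ (fun k => ?_) ?_
      · push_cast; ring_nf
      · rw [if_neg j.succ_ne_zero, ← sum_range_reflect]
        push_cast
        congr 1
        refine sum_congr rfl fun i hi => ?_
        rw [mem_range] at hi
        rw [Nat.cast_sub (by omega)]
        ring_nf
  · obtain ⟨c, rfl⟩ := Nat.exists_eq_succ_of_ne_zero hc.ne'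
    rw [sum_range_succ']
    simp [add_comm]

open Finset in
theorem hasSum_upper_neg_one (c : ℕ) (hc : 0 < c) :
    HasSum (fun p : ℕ × ℕ => if p.1 < p.2 ∧ c < p.1 then
      1 / (p.1 * ((p.2 : ℝ) * (p.2 - (-1) * c))) else 0)
      ((∑ j ∈ range c, 1 / ((j : ℝ) + 1) * ∑ i ∈ range (j + 1), 1 / ((c : ℝ) + 1 + i)) / c) := by
  refine hasSum_pair_of_nonneg (f := fun b a : ℕ => 1 / (b * ((a : ℝ) * (a - (-1) * c))))
    (g := fun j b => 1 / (b * ((b : ℝ) + 1 + j))) (fun b a hb ha => ?_) (fun b hb => ?_)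
    (fun j hj => hasSum_ite_lt_one_div_mul_add c j (c + 1) (by positivity) _ _ (fun k => ?_) rfl) rfl
  · rw [neg_one_mul, sub_neg_eq_add]
    positivity
  · refine hasSum_ite_lt b ?_
    have h := (hasSum_one_div_mul_add ((b : ℝ) + 1) (by positivity) c hc).mul_left (1 / (b : ℝ))
    have hv : 1 / (c : ℝ) * ∑ j ∈ range c, 1 / (b * ((b : ℝ) + 1 + j)) =
        1 / (b : ℝ) * (1 / c * ∑ j ∈ range c, 1 / ((b : ℝ) + 1 + j)) := by
      rw [mul_left_comm, mul_sum (range c) _ (1 / (b : ℝ))]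
      simp only [one_div_mul_one_div]
    rw [hv]
    refine h.congr_fun fun k => ?_
    rw [one_div_mul_one_div]
    push_cast
    ring_nf
  · push_cast; ring_nf

open Finset in
theorem upper_sub_innerSum_one (c : ℕ) :
    (sqTail c + ∑ j ∈ range (c - 1), 1 / ((j : ℝ) + 1) * ∑ i ∈ range (j + 1), 1 / ((c : ℝ) - i)) -
      innerSum 1 c = sqTail c + 1 / c * ∑ j ∈ range (c - 1), 1 / ((j : ℝ) + 1) := by
  have h : ∑ j ∈ range (c - 1), 1 / ((j : ℝ) + 1) * ∑ i ∈ range (j + 1), 1 / ((c : ℝ) - i) =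
      innerSum 1 c + 1 / c * ∑ j ∈ range (c - 1), 1 / ((j : ℝ) + 1) := by
    rw [innerSum, mul_sum, ← sum_add_distrib]
    refine sum_congr rfl fun j _ => ?_
    rw [sum_range_succ']
    push_cast
    simp only [one_mul, sub_zero]
    ring
  rw [h]
  ring

open Finset in
theorem upper_sub_innerSum_neg_one (c : ℕ) :
    (∑ j ∈ range c, 1 / ((j : ℝ) + 1) * ∑ i ∈ range (j + 1), 1 / ((c : ℝ) + 1 + i)) -
      innerSum (-1) c = 1 / (2 * (c : ℝ) ^ 2) + 1 / c * ∑ j ∈ range (c - 1), 1 / ((j : ℝ) + 1) := by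
  rcases c with _ | n
  · simp [innerSum]
  have h1 : ∑ j ∈ range n, 1 / ((j : ℝ) + 1) * ∑ i ∈ range (j + 1), 1 / (((n + 1 : ℕ) : ℝ) + 1 + i) =
      innerSum (-1) (n + 1 : ℕ) + 1 / ((n + 1 : ℕ) : ℝ) * (∑ j ∈ range n, 1 / ((j : ℝ) + 1) -
        ∑ j ∈ range n, 1 / (((n + 1 : ℕ) : ℝ) + 1 + j)) := by
    rw [innerSum, Nat.add_sub_cancel, ← sum_sub_distrib, mul_sum, ← sum_add_distrib]
    refine sum_congr rfl fun j _ => ?_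
    rw [sum_range_succ, mul_add]
    congr 1
    · congr 1
      exact sum_congr rfl fun i _ => by ring_nf
    · push_cast
      field_simp
      ring
  rw [sum_range_succ, h1, sum_range_succ, Nat.add_sub_cancel]
  push_cast
  field_simp
  ring

theorem hasSum_rz {k : ℕ} (hk : 1 < k) : HasSum (fun m : ℕ => 1 / (m : ℝ) ^ k) (rz k) := by
  have h := (Real.summable_one_div_nat_pow.2 hk).hasSum
  convert h using 1
  refine tsum_congr fun m => ?_
  rcases Nat.eq_zero_or_pos m with rfl | hm
  · simp [show k ≠ 0 by omega]
  · rw [if_pos hm]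

theorem hasSum_dz_two {q : ℕ} (hq : 1 ≤ q) :
    HasSum (fun c : ℕ => sqTail c / (c : ℝ) ^ (q + 1)) (dz 2 (q + 1)) := by
  have hs : Summable (fun c : ℕ => sqTail c / (c : ℝ) ^ (q + 1)) := by
    refine Summable.of_nonneg_of_le (fun c => div_nonneg (sqTail_nonneg c) (by positivity))
      (fun c => ?_) ((Real.summable_one_div_nat_pow.2 (show 1 < q + 1 by omega)).mul_left (sqTail 0))
    rw [mul_one_div]
    exact div_le_div_of_nonneg_right (sqTail_le c) (by positivity)
  have h : HasSum (fun p : ℕ × ℕ => if p.1 < p.2 ∧ 0 < p.1 then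
      1 / ((p.2 : ℝ) ^ 2 * (p.1 : ℝ) ^ (q + 1)) else 0)
      (∑' c : ℕ, sqTail c / (c : ℝ) ^ (q + 1)) := by
    refine hasSum_prod_of_nonneg (fun p => by positivity) (fun c => ?_) hs.hasSum
    rcases Nat.eq_zero_or_pos c with rfl | hc
    · simp [hasSum_zero]
    · refine ((hasSum_sqTail c).div_const _).congr_fun fun m => ?_
      simp only [hc, and_true]
      split_ifs
      · rw [div_div]
      · simp
  have h2 := ((Equiv.prodComm ℕ ℕ).hasSum_iff (f := fun p : ℕ × ℕ => if p.2 < p.1 ∧ 0 < p.2 then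
    1 / ((p.1 : ℝ) ^ 2 * (p.2 : ℝ) ^ (q + 1)) else 0)).1 h
  rw [dz, h2.tsum_eq]
  exact hs.hasSum

theorem hasSum_dz_one {q : ℕ} (hq : 1 ≤ q) :
    HasSum (fun a : ℕ => (1 / (a : ℝ) * ∑ j ∈ Finset.range (a - 1), 1 / ((j : ℝ) + 1)) /
      (a : ℝ) ^ (q + 1)) (dz (q + 2) 1) := by
  have hs : Summable (fun a : ℕ => (1 / (a : ℝ) * ∑ j ∈ Finset.range (a - 1), 1 / ((j : ℝ) + 1)) /
      (a : ℝ) ^ (q + 1)) := by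
    refine Summable.of_nonneg_of_le (fun a => by positivity) (fun a => ?_)
      (Real.summable_one_div_nat_pow.2 (show 1 < q + 1 by omega))
    refine div_le_div_of_nonneg_right ?_ (by positivity)
    have h : ∑ j ∈ Finset.range (a - 1), 1 / ((j : ℝ) + 1) ≤ ∑ j ∈ Finset.range (a - 1), (1 : ℝ) :=
      Finset.sum_le_sum fun j _ => (div_le_one (by positivity)).2 (by simp)
    rw [one_div_mul_eq_div]
    refine div_le_one_of_le₀ (h.trans ?_) (by positivity)
    simp
  have h : HasSum (fun p : ℕ × ℕ => if p.2 < p.1 ∧ 0 < p.2 then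
      1 / ((p.1 : ℝ) ^ (q + 2) * (p.2 : ℝ) ^ 1) else 0) (∑' a : ℕ, (1 / (a : ℝ) *
        ∑ j ∈ Finset.range (a - 1), 1 / ((j : ℝ) + 1)) / (a : ℝ) ^ (q + 1)) := by
    refine hasSum_prod_of_nonneg (fun p => by positivity) (fun a => ?_) hs.hasSum
    have h := hasSum_sum_of_ne_finset_zero (L := .unconditional ℕ) (s := Finset.range a) (f := fun b : ℕ =>
      if b < a ∧ 0 < b then 1 / ((a : ℝ) ^ (q + 2) * (b : ℝ) ^ 1) else 0)
      (fun b hb => if_neg fun h => hb (Finset.mem_range.2 h.1))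
    convert h using 1
    rcases a with _ | a
    · simp
    · rw [Finset.sum_range_succ', Nat.add_sub_cancel, Finset.mul_sum, Finset.sum_div]
      simp only [lt_irrefl, and_false, if_false, add_zero]
      refine Finset.sum_congr rfl fun j hj => ?_
      rw [Finset.mem_range] at hj
      rw [if_pos ⟨by omega, by omega⟩]
      push_cast
      field_simp
      ring
  rw [dz, h.tsum_eq]
  exact hs.hasSum

theorem hasSum_sum_tzTerm {q : ℕ} (hq : Even q) (hq2 : 2 ≤ q) :
    HasSum (fun t => ∑ i ∈ Finset.Icc 2 (q + 1), (1 : ℝ) ^ i * tzTerm i 1 (q + 2 - i) t)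
      (dz 2 (q + 1) + dz (q + 2) 1) := by
  refine hasSum_signed_tzTerm (Or.inl rfl) hq hq2 hasSum_upper_one ?_
  refine ((hasSum_dz_two (by omega)).add (hasSum_dz_one (by omega))).congr_fun fun c => ?_
  rw [upper_sub_innerSum_one, add_div]

theorem hasSum_alternating_tzTerm {q : ℕ} (hq : Even q) (hq2 : 2 ≤ q) :
    HasSum (fun t => ∑ i ∈ Finset.Icc 2 (q + 1), (-1 : ℝ) ^ i * tzTerm i 1 (q + 2 - i) t)
      (1 / 2 * rz (q + 3) + dz (q + 2) 1) := by
  refine hasSum_signed_tzTerm (Or.inr rfl) hq hq2 hasSum_upper_neg_one ?_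
  refine (((hasSum_rz (by omega)).mul_left _).add (hasSum_dz_one (by omega))).congr_fun fun c => ?_
  rw [upper_sub_innerSum_neg_one, add_div]
  congr 1
  simp only [div_eq_mul_inv, mul_inv, one_mul]
  ring

theorem hasSum_tz {q i : ℕ} (hq : Even q) (hq2 : 2 ≤ q) (hi : i ∈ Finset.Icc 2 (q + 1)) :
    HasSum (tzTerm i 1 (q + 2 - i)) (tz i 1 (q + 2 - i)) := by
  refine Summable.hasSum (Summable.of_nonneg_of_le (tzTerm_nonneg _ _ _) (fun t => ?_)
    (hasSum_sum_tzTerm hq hq2).summable)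
  simp only [one_pow, one_mul]
  exact Finset.single_le_sum (f := fun i => tzTerm i 1 (q + 2 - i) t)
    (fun _ _ => tzTerm_nonneg _ _ _ t) hi

theorem sum_tz {q : ℕ} (hq : Even q) (hq2 : 2 ≤ q) :
    ∑ i ∈ Finset.Icc 2 (q + 1), tz i 1 (q + 2 - i) = dz 2 (q + 1) + dz (q + 2) 1 := by
  have h := hasSum_sum_tzTerm hq hq2
  simp only [one_pow, one_mul] at h
  exact (hasSum_sum fun _ hi => hasSum_tz hq hq2 hi).unique h

theorem sum_alternating_tz {q : ℕ} (hq : Even q) (hq2 : 2 ≤ q) :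
    ∑ i ∈ Finset.Icc 2 (q + 1), (-1 : ℝ) ^ i * tz i 1 (q + 2 - i) =
      1 / 2 * rz (q + 3) + dz (q + 2) 1 :=
  (hasSum_sum fun _ hi => (hasSum_tz hq hq2 hi).mul_left _).unique (hasSum_alternating_tzTerm hq hq2)

theorem restricted_sum_middle_one (l : ℕ) (hl : 5 ≤ l) (hodd : Odd l) :
    (∑ l1 ∈ (Finset.Icc 2 (l - 2)).filter (fun l1 => Even l1 ∧ Even (l - 1 - l1)),
      tz l1 1 (l - 1 - l1)) = 1 / 4 * rz l + dz (l - 1) 1 + 1 / 2 * dz 2 (l - 2) ∧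
    (∑ l1 ∈ (Finset.Icc 3 (l - 2)).filter (fun l1 => Odd l1 ∧ Odd (l - 1 - l1)),
      tz l1 1 (l - 1 - l1)) = -(1 / 4) * rz l + 1 / 2 * dz 2 (l - 2) := by
  obtain ⟨q, rfl⟩ : ∃ q, l = q + 3 := ⟨l - 3, by omega⟩
  have hq : Even q := by rw [Nat.odd_iff] at hodd; rw [Nat.even_iff]; omega
  have hq2 : 2 ≤ q := by omega
  rw [Nat.even_iff] at hq
  simp only [show q + 3 - 2 = q + 1 by omega, show q + 3 - 1 = q + 2 by omega]
  have hE : (Finset.Icc 2 (q + 1)).filter (fun i => Even i ∧ Even (q + 2 - i)) =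
      (Finset.Icc 2 (q + 1)).filter (fun i => Even i) := by
    ext i
    simp only [Finset.mem_filter, Finset.mem_Icc, Nat.even_iff]
    omega
  have hO : (Finset.Icc 3 (q + 1)).filter (fun i => Odd i ∧ Odd (q + 2 - i)) =
      (Finset.Icc 2 (q + 1)).filter (fun i => ¬ Even i) := by
    ext i
    simp only [Finset.mem_filter, Finset.mem_Icc, Nat.even_iff, Nat.odd_iff]
    omega
  rw [hE, hO]
  have h1 := sum_tz (Nat.even_iff.2 hq) hq2
  have h2 := sum_alternating_tz (Nat.even_iff.2 hq) hq2
  rw [← Finset.sum_filter_add_sum_filter_not _ (fun i => Even i)] at h1 h2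
  rw [Finset.sum_congr rfl (g := fun i => tz i 1 (q + 2 - i)) (fun i hi => by
      rw [(Finset.mem_filter.1 hi).2.neg_one_pow, one_mul]),
    Finset.sum_congr (s₁ := (Finset.Icc 2 (q + 1)).filter (fun i => ¬ Even i)) rfl
      (g := fun i => -tz i 1 (q + 2 - i)) (fun i hi => by
      rw [(Nat.not_even_iff_odd.1 (Finset.mem_filter.1 hi).2).neg_one_pow, neg_one_mul]),
    Finset.sum_neg_distrib] at h2
  constructor <;> linarith
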